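/- If f : (k+1)^V → ℝ is k-submodular, then for all x, y ∈ Δ_k^V with y_{e',j'} ≤ x_{e',j'} for every coordinate (e',j'), the k-multilinear extension F satisfies ∂F/∂x_{e,j}(y) ≥ ∂F/∂x_{e,j}(x) for every e ∈ V and every j ∈ {1,…,k}. -/

import Mathlib

open Finset

section KSubmodularDefs

variable {V : Type*} [Fintype V] [DecidableEq V] {k : ℕ}

/-- The support of a `k`-tuple `x : V → Fin (k+1)` (value `0` means "not selected"). -/
def ksupp (x : V → Fin (k+1)) : Finset V := Finset.univ.filter fun e => x e ≠ 0

/-- The meet `x ⊓ y`. -/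
def kinf (x y : V → Fin (k+1)) : V → Fin (k+1) :=
  fun e => if x e = y e then x e else 0

/-- The join `x ⊔ y`. -/
def ksup (x y : V → Fin (k+1)) : V → Fin (k+1) :=
  fun e => if y e = 0 ∨ y e = x e then x e else if x e = 0 then y e else 0

/-- `f` is `k`-submodular. -/
def KSubmodular (f : (V → Fin (k+1)) → ℝ) : Prop :=
  ∀ x y : V → Fin (k+1), f (ksup x y) + f (kinf x y) ≤ f x + f y

/-- The partial order `x ⪯ y` on `(k+1)^V`. -/
def kle (x y : V → Fin (k+1)) : Prop := ∀ e : V, x e = 0 ∨ x e = y e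

/-- `f` is monotone with respect to `⪯`. -/
def KMonotone (f : (V → Fin (k+1)) → ℝ) : Prop :=
  ∀ x y : V → Fin (k+1), kle x y → f x ≤ f y

/-- The marginal gain `Δ_{e,j}(x)` of assigning element `e` to component `j`. -/
def margin (f : (V → Fin (k+1)) → ℝ) (x : V → Fin (k+1)) (e : V) (j : Fin (k+1)) : ℝ :=
  f (Function.update x e j) - f x

/-- The total cost `c(x)` of a tuple. -/
def kcost (c : V → ℝ) (x : V → Fin (k+1)) : ℝ := ∑ e ∈ ksupp x, c e

/-- One step of a greedy sequence relative to `o`: pick `e ∉ supp x` and `j ∈ {1,…,k}`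
maximizing the marginal gain over components (a), and with marginal density at least that of
every pair `(e', j')` with `e' ∈ supp o \ supp x` (b). -/
def GreedyStep (f : (V → Fin (k+1)) → ℝ) (c : V → ℝ) (o : V → Fin (k+1))
    (x x' : V → Fin (k+1)) : Prop :=
  ∃ e : V, ∃ j : Fin (k+1), x e = 0 ∧ j ≠ 0 ∧ x' = Function.update x e j ∧
    (∀ j' : Fin (k+1), j' ≠ 0 → margin f x e j' ≤ margin f x e j) ∧
    (∀ e' : V, o e' ≠ 0 → x e' = 0 → ∀ j' : Fin (k+1), j' ≠ 0 →
      margin f x e' j' * c e ≤ margin f x e j * c e')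

/-- `GreedyRun f c B s V0 out`: starting from partial solution `s` with remaining elements `V0`,
the greedy procedure with budget `B` (under some tie-breaking) can terminate with output `out`.
At each step a pair `(e, j)` of maximum marginal density among remaining elements is chosen;
`e` is added (placed in component `j`) iff it fits in the remaining budget, and is removed
from the remaining pool in either case. -/
inductive GreedyRun (f : (V → Fin (k+1)) → ℝ) (c : V → ℝ) (B : ℝ) :
    (V → Fin (k+1)) → Finset V → (V → Fin (k+1)) → Prop where
  | done (s : V → Fin (k+1)) : GreedyRun f c B s ∅ s
  | take (s : V → Fin (k+1)) (V0 : Finset V) (e : V) (j : Fin (k+1))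
      (out : V → Fin (k+1)) (he : e ∈ V0) (hj : j ≠ 0)
      (hbest : ∀ e' ∈ V0, ∀ j' : Fin (k+1), j' ≠ 0 →
        margin f s e' j' / c e' ≤ margin f s e j / c e)
      (hfit : kcost c s + c e ≤ B)
      (hrest : GreedyRun f c B (Function.update s e j) (V0.erase e) out) :
      GreedyRun f c B s V0 out
  | skip (s : V → Fin (k+1)) (V0 : Finset V) (e : V) (j : Fin (k+1))
      (out : V → Fin (k+1)) (he : e ∈ V0) (hj : j ≠ 0)
      (hbest : ∀ e' ∈ V0, ∀ j' : Fin (k+1), j' ≠ 0 →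
        margin f s e' j' / c e' ≤ margin f s e j / c e)
      (hnofit : ¬ kcost c s + c e ≤ B)
      (hrest : GreedyRun f c B s (V0.erase e) out) :
      GreedyRun f c B s V0 out

/-- The `k`-multilinear extension of `f`, as a function of `x : V → Fin (k+1) → ℝ`
(only the coordinates `x e j` with `j ≠ 0` are relevant). -/
noncomputable def kext (f : (V → Fin (k+1)) → ℝ) (x : V → Fin (k+1) → ℝ) : ℝ :=
  ∑ s : V → Fin (k+1), f s *
    ∏ e : V,
      (if s e = 0 then 1 - ∑ j ∈ Finset.univ.erase (0 : Fin (k+1)), x e j else x e (s e))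

/-- The partial derivative of `F` with respect to the coordinate `(e, j)` at the point `x`. -/
noncomputable def pderiv (F : (V → Fin (k+1) → ℝ) → ℝ) (e : V) (j : Fin (k+1))
    (x : V → Fin (k+1) → ℝ) : ℝ :=
  deriv (fun t : ℝ => F (Function.update x e (Function.update (x e) j t))) (x e j)

/-- Membership in the domain `Δ_k^V` of the multilinear extension. -/
def inSimplex (x : V → Fin (k+1) → ℝ) : Prop :=
  (∀ e : V, ∀ j : Fin (k+1), j ≠ 0 → 0 ≤ x e j ∧ x e j ≤ 1) ∧
  (∀ e : V, ∑ j ∈ Finset.univ.erase (0 : Fin (k+1)), x e j ≤ 1)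

end KSubmodularDefs

section KextLemmas

variable {V : Type*} {k : ℕ}

/-- The weight of the value `i` under the marginal `v` at a single element. -/
noncomputable def kweight (v : Fin (k+1) → ℝ) (i : Fin (k+1)) : ℝ :=
  if i = 0 then 1 - ∑ j ∈ Finset.univ.erase (0 : Fin (k+1)), v j else v i

lemma sum_kweight_mul (v A : Fin (k+1) → ℝ) :
    ∑ i, kweight v i * A i =
      A 0 + ∑ i ∈ Finset.univ.erase (0 : Fin (k+1)), v i * (A i - A 0) := by
  rw [← Finset.add_sum_erase _ _ (Finset.mem_univ (0 : Fin (k+1)))]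
  have h : ∑ i ∈ Finset.univ.erase (0 : Fin (k+1)), kweight v i * A i =
      ∑ i ∈ Finset.univ.erase (0 : Fin (k+1)), v i * A i :=
    Finset.sum_congr rfl fun i hi => by simp [kweight, Finset.ne_of_mem_erase hi]
  rw [h]
  simp only [kweight, if_true, mul_sub, Finset.sum_sub_distrib, ← Finset.sum_mul]
  ring

lemma sum_kweight (v : Fin (k+1) → ℝ) : ∑ i, kweight v i = 1 := by
  simpa using sum_kweight_mul v fun _ => 1

lemma inSimplex.kweight_nonneg {x : V → Fin (k+1) → ℝ} (hx : inSimplex x) (e : V)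
    (i : Fin (k+1)) : 0 ≤ kweight (x e) i := by
  unfold kweight
  split_ifs with h
  · linarith [hx.2 e]
  · exact (hx.1 e i h).1

variable [DecidableEq V]

lemma inSimplex.piecewise {x y : V → Fin (k+1) → ℝ} (hx : inSimplex x) (hy : inSimplex y)
    (S : Finset V) : inSimplex (S.piecewise x y) := by
  refine ⟨fun e j hj => ?_, fun e => ?_⟩ <;> by_cases h : e ∈ S <;> simp only [h,
    Finset.piecewise_eq_of_mem, Finset.piecewise_eq_of_notMem, not_false_eq_true]
  exacts [hx.1 e j hj, hy.1 e j hj, hx.2 e, hy.2 e]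

/-- Marginal gains of a `k`-submodular function decrease as the tuple grows. -/
lemma KSubmodular.margin_update_le {f : (V → Fin (k+1)) → ℝ} (hsub : KSubmodular f) (e : V)
    (j : Fin (k+1)) (s : V → Fin (k+1)) (a : V) (i : Fin (k+1)) :
    f (Function.update (Function.update s a i) e j) -
        f (Function.update (Function.update s a i) e 0) ≤
      f (Function.update (Function.update s a 0) e j) -
        f (Function.update (Function.update s a 0) e 0) := by
  obtain rfl | hae := eq_or_ne a e
  · simp
  have h := hsub (Function.update (Function.update s a 0) e j)
    (Function.update (Function.update s a i) e 0)
  have hsup : ksup (Function.update (Function.update s a 0) e j)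
      (Function.update (Function.update s a i) e 0) =
      Function.update (Function.update s a i) e j := by
    funext b
    simp only [ksup, Function.update_apply]
    grind
  have hinf : kinf (Function.update (Function.update s a 0) e j)
      (Function.update (Function.update s a i) e 0) =
      Function.update (Function.update s a 0) e 0 := by
    funext b
    simp only [kinf, Function.update_apply]
    grind
  rw [hsup, hinf] at h
  linarith

variable [Fintype V]

lemma kext_eq_sum_kweight (f : (V → Fin (k+1)) → ℝ) (x : V → Fin (k+1) → ℝ) :
    kext f x = ∑ s : V → Fin (k+1), f s * ∏ e : V, kweight (x e) (s e) := rfl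

lemma kext_mono {g h : (V → Fin (k+1)) → ℝ} (hgh : ∀ s, g s ≤ h s)
    {x : V → Fin (k+1) → ℝ} (hx : inSimplex x) : kext g x ≤ kext h x :=
  Finset.sum_le_sum fun s _ => mul_le_mul_of_nonneg_right (hgh s)
    (Finset.prod_nonneg fun e _ => hx.kweight_nonneg e (s e))

lemma kext_sub (g h : (V → Fin (k+1)) → ℝ) (x : V → Fin (k+1) → ℝ) :
    kext (fun s => g s - h s) x = kext g x - kext h x := by
  simp only [kext, sub_mul, Finset.sum_sub_distrib]

/-- Conditioning the `k`-multilinear extension on the value at `e`. -/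
lemma kext_update (g : (V → Fin (k+1)) → ℝ) (x : V → Fin (k+1) → ℝ) (e : V)
    (v : Fin (k+1) → ℝ) :
    kext g (Function.update x e v) =
      ∑ i, kweight v i * kext (fun s => g (Function.update s e i)) x := by
  have hprod : ∀ (z : V → Fin (k+1) → ℝ) (s : V → Fin (k+1)),
      ∏ a, kweight (z a) (s a) =
        kweight (z e) (s e) * ∏ a ∈ Finset.univ.erase e, kweight (z a) (s a) :=
    fun z s => (Finset.mul_prod_erase _ _ (Finset.mem_univ e)).symm
  have hupd : ∀ s : V → Fin (k+1),
      ∏ a ∈ Finset.univ.erase e, kweight (Function.update x e v a) (s a) =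
        ∏ a ∈ Finset.univ.erase e, kweight (x a) (s a) :=
    fun s => Finset.prod_congr rfl fun a ha => by
      rw [Function.update_of_ne (Finset.ne_of_mem_erase ha)]
  have hswap : Function.Involutive fun p : Fin (k+1) × (V → Fin (k+1)) =>
      (p.2 e, Function.update p.2 e p.1) := fun p => by simp
  simp only [kext_eq_sum_kweight, Finset.mul_sum]
  rw [← Fintype.sum_prod_type' (f := fun i s => kweight v i *
    (g (Function.update s e i) * ∏ a, kweight (x a) (s a))),
    ← Equiv.sum_comp hswap.toPerm, Fintype.sum_prod_type, Finset.sum_comm]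
  refine Finset.sum_congr rfl fun s _ => ?_
  have hs : ∀ i : Fin (k+1), ∏ a ∈ Finset.univ.erase e,
      kweight (x a) (Function.update s e i a) =
        ∏ a ∈ Finset.univ.erase e, kweight (x a) (s a) :=
    fun i => Finset.prod_congr rfl fun a ha => by
      rw [Function.update_of_ne (Finset.ne_of_mem_erase ha)]
  simp only [Function.Involutive.coe_toPerm, Function.update_idem, Function.update_eq_self,
    hprod, hupd, hs, Function.update_self]
  rw [← mul_one (g s * _), ← sum_kweight (x e), Finset.mul_sum]
  exact Finset.sum_congr rfl fun i _ => by ring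

/-- A partial derivative of the extension is the extension of the discrete derivative. -/
lemma pderiv_kext (f : (V → Fin (k+1)) → ℝ) (x : V → Fin (k+1) → ℝ) (e : V)
    {j : Fin (k+1)} (hj : j ≠ 0) :
    pderiv (kext f) e j x =
      kext (fun s => f (Function.update s e j) - f (Function.update s e 0)) x := by
  rw [kext_sub]
  set A : Fin (k+1) → ℝ := fun i => kext (fun s => f (Function.update s e i)) x
  have hmem : j ∈ Finset.univ.erase (0 : Fin (k+1)) := by simp [hj]
  have hfun : (fun t : ℝ => kext f (Function.update x e (Function.update (x e) j t))) =
      fun t => t * (A j - A 0) +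
        (A 0 + ∑ i ∈ (Finset.univ.erase (0 : Fin (k+1))).erase j, x e i * (A i - A 0)) := by
    funext t
    rw [kext_update, sum_kweight_mul _ A, ← Finset.add_sum_erase _ _ hmem,
      Function.update_self, Finset.sum_congr rfl fun i hi => by
        rw [Function.update_of_ne (Finset.ne_of_mem_erase hi)]]
    ring
  rw [pderiv, hfun]
  simpa only [id, one_mul] using
    (((hasDerivAt_id (x e j)).mul_const (A j - A 0)).add_const _).deriv

/-- Lowering one marginal increases the extension of a function that is antitone in that
element. -/
lemma kext_le_kext_update {g : (V → Fin (k+1)) → ℝ} {x : V → Fin (k+1) → ℝ}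
    (hx : inSimplex x) (e : V) {v : Fin (k+1) → ℝ}
    (hg : ∀ s, ∀ i, g (Function.update s e i) ≤ g (Function.update s e 0))
    (hv : ∀ i, i ≠ 0 → v i ≤ x e i) :
    kext g x ≤ kext g (Function.update x e v) := by
  conv_lhs => rw [← Function.update_eq_self e x]
  rw [kext_update, kext_update, sum_kweight_mul, sum_kweight_mul]
  refine add_le_add le_rfl (Finset.sum_le_sum fun i hi => ?_)
  exact mul_le_mul_of_nonpos_right (hv i (Finset.ne_of_mem_erase hi))
    (sub_nonpos.2 (kext_mono (fun s => hg s i) hx))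

lemma kext_antitone {g : (V → Fin (k+1)) → ℝ}
    (hg : ∀ s e i, g (Function.update s e i) ≤ g (Function.update s e 0))
    {x y : V → Fin (k+1) → ℝ} (hx : inSimplex x) (hy : inSimplex y)
    (hle : ∀ e : V, ∀ j : Fin (k+1), j ≠ 0 → y e j ≤ x e j) :
    kext g x ≤ kext g y := by
  have key : ∀ S : Finset V, kext g x ≤ kext g (S.piecewise y x) := fun S => by
    induction S using Finset.induction_on with
    | empty => simp
    | insert a S ha ih =>
      rw [Finset.piecewise_insert]
      refine ih.trans (kext_le_kext_update (hy.piecewise hx S) a (fun s => hg s a) ?_)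
      rw [Finset.piecewise_eq_of_notMem _ _ _ ha]
      exact hle a
  simpa using key Finset.univ

end KextLemmas

/-- If `f` is `k`-submodular, the partial derivatives of its `k`-multilinear
extension are antitone along the coordinatewise order on `Δ_k^V`. -/
theorem kext_deriv_antitone
    {V : Type*} [Fintype V] [DecidableEq V] {k : ℕ} (hk : 1 ≤ k)
    (f : (V → Fin (k+1)) → ℝ) (hsub : KSubmodular f)
    (x y : V → Fin (k+1) → ℝ) (hx : inSimplex x) (hy : inSimplex y)
    (hle : ∀ e : V, ∀ j : Fin (k+1), j ≠ 0 → y e j ≤ x e j)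
    (e : V) (j : Fin (k+1)) (hj : j ≠ 0) :
    pderiv (kext f) e j x ≤ pderiv (kext f) e j y := by
  rw [pderiv_kext f x e hj, pderiv_kext f y e hj]
  exact kext_antitone (hsub.margin_update_le e j) hx hy hle
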